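/- Let k ≥ 3 be an integer, let K be an algebraically closed field whose characteristic does not divide k, and let G = (V,E) be a finite simple graph with chromatic number exactly k+1 and girth g satisfying g > 4k. Then for every natural number d with 4k(d + k − 1) < g there exists a dual Nullstellensatz certificate of degree d for G over K, i.e., a family of scalars λ_α ∈ K indexed by α : V → ZMod k with λ_0 = 1 and, for every α with |α| ≤ d and every edge {u,v} ∈ E, Σ_{r ∈ ZMod k} λ_{α + r·(e_u − e_v) − e_v} = 0. -/

import Mathlib

/-- `lam` is a dual Nullstellensatz certificate of degree `d` for the graph `G` and
`k` colors: `lam 0 = 1`, and for every exponent vector `α : V → ZMod k` with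
`|α| = Σ_v (α v).val ≤ d` and every edge `{u,v}` of `G`,
`Σ_{r ∈ ZMod k} lam (α + r (e_u - e_v) - e_v) = 0` (the sum over `ZMod k` being
realized as a sum over `r ∈ range k` of the casts `(r : ZMod k)`). -/
def IsDualCert (K : Type*) [CommRing K] {V : Type*} [Fintype V] [DecidableEq V]
    (G : SimpleGraph V) (k d : ℕ) (lam : (V → ZMod k) → K) : Prop :=
  lam 0 = 1 ∧
  ∀ α : V → ZMod k, (∑ v, (α v).val) ≤ d → ∀ u v : V, G.Adj u v →
    ∑ r ∈ Finset.range k,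
      lam (α + (r : ZMod k) • (Pi.single u 1 - Pi.single v 1) - Pi.single v 1) = 0

section Forest

variable {V : Type*} [Fintype V] {H : SimpleGraph V}

open scoped Classical in
/-- In a forest with an edge, there are fewer edges than non-isolated vertices. -/
theorem SimpleGraph.IsAcyclic.sum_degree_add_two_le (hH : H.IsAcyclic) (hne : H ≠ ⊥) :
    ∑ v, H.degree v + 2 ≤ 2 * (Finset.univ.filter fun v => 0 < H.degree v).card := by
  obtain ⟨u, v, huv⟩ := SimpleGraph.ne_bot_iff_exists_adj.1 hne
  let S : Set V := {v | 0 < H.degree v}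
  have hu : u ∈ S := (H.degree_pos_iff_exists_adj u).2 ⟨v, huv⟩
  have : Nonempty S := ⟨⟨u, hu⟩⟩
  obtain ⟨T, hle, -, hT⟩ :=
    (SimpleGraph.connected_top (V := S)).exists_isTree_le_of_le_of_isAcyclic le_top (hH.induce S)
  have hcard : (H.induce S).edgeFinset.card + 1 ≤ Fintype.card S := by
    rw [← hT.card_edgeFinset]
    exact Nat.add_le_add_right (Finset.card_le_card (SimpleGraph.edgeFinset_mono hle)) 1
  have hdeg (w : S) : (H.induce S).degree w = H.degree w := by
    refine SimpleGraph.degree_induce_of_neighborSet_subset fun x hx => ?_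
    exact (H.degree_pos_iff_exists_adj x).2 ⟨w, hx.symm⟩
  have hsum : ∑ v, H.degree v = ∑ w : S, (H.induce S).degree w := by
    simp_rw [hdeg]
    rw [← Finset.sum_subtype (Finset.univ.filter (· ∈ S)) (by simp) fun v => H.degree v]
    exact (Finset.sum_filter_of_ne fun v _ hv => Nat.pos_of_ne_zero hv).symm
  rw [hsum, SimpleGraph.sum_degrees_eq_twice_card_edges]
  have : Fintype.card S = (Finset.univ.filter fun v => 0 < H.degree v).card :=
    Fintype.card_subtype _
  lia

open scoped Classical in
theorem SimpleGraph.IsAcyclic.exists_degree_eq_one (hH : H.IsAcyclic) (hne : H ≠ ⊥) :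
    ∃ v, H.degree v = 1 := by
  by_contra! h
  have hsum : 2 * (Finset.univ.filter fun v => 0 < H.degree v).card ≤ ∑ v, H.degree v := by
    rw [Finset.card_filter, Finset.mul_sum]
    refine Finset.sum_le_sum fun v _ => ?_
    have := h v
    split_ifs <;> lia
  have := hH.sum_degree_add_two_le hne
  lia

open scoped Classical in
theorem SimpleGraph.IsAcyclic.card_three_le_degree_le (hH : H.IsAcyclic) :
    (Finset.univ.filter fun v => 3 ≤ H.degree v).card ≤
      (Finset.univ.filter fun v => H.degree v = 1).card := by
  rcases eq_or_ne H ⊥ with rfl | hne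
  · simp
  have hsum : 2 * (Finset.univ.filter fun v => 0 < H.degree v).card +
      (Finset.univ.filter fun v => 3 ≤ H.degree v).card ≤
      ∑ v, H.degree v + (Finset.univ.filter fun v => H.degree v = 1).card := by
    simp only [Finset.card_filter, Finset.mul_sum, ← Finset.sum_add_distrib]
    refine Finset.sum_le_sum fun v _ => ?_
    split_ifs <;> lia
  have := hH.sum_degree_add_two_le hne
  lia

end Forest

section Boundary

variable {V : Type*} [Fintype V] {H : SimpleGraph V} {c : V → ℕ} {k : ℕ}

open scoped Classical in
/-- The boundary modulo `k` of the graph `H`, each edge being oriented from its endpoint with the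
larger value of `c` to the one with the smaller value. -/
noncomputable def orientedBoundary (k : ℕ) (c : V → ℕ) (H : SimpleGraph V) : V → ZMod k :=
  fun w => ∑ x, if H.Adj w x then (if c x < c w then 1 else -1) else 0

open scoped Classical in
theorem orientedBoundary_eq_sum_neighborFinset (w : V) :
    orientedBoundary k c H w = ∑ x ∈ H.neighborFinset w, if c x < c w then 1 else -1 := by
  rw [orientedBoundary, ← Finset.sum_filter]
  refine Finset.sum_congr ?_ fun _ _ => rfl
  ext x
  simp

theorem ZMod.natCast_ne_zero_of_lt {m : ℕ} (hm : 0 < m) (hmk : m < k) : (m : ZMod k) ≠ 0 := by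
  rw [Ne, ZMod.natCast_eq_zero_iff]
  exact Nat.not_dvd_of_pos_of_lt hm hmk

open scoped Classical in
theorem orientedBoundary_ne_zero_of_degree_eq_one (hk : 3 ≤ k) {w : V} (hw : H.degree w = 1) :
    orientedBoundary k c H w ≠ 0 := by
  obtain ⟨x, hx⟩ := Finset.card_eq_one.1 hw
  rw [orientedBoundary_eq_sum_neighborFinset, hx, Finset.sum_singleton]
  have h1 : (1 : ZMod k) ≠ 0 := by
    exact_mod_cast ZMod.natCast_ne_zero_of_lt (k := k) one_pos (by lia)
  split_ifs
  · exact h1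
  · exact neg_ne_zero.2 h1

open scoped Classical in
/-- Flow conservation at a vertex of degree two forces the flow to pass straight through. -/
theorem lt_iff_lt_of_orientedBoundary_eq_zero (hk : 3 ≤ k) (hc : ∀ a b, H.Adj a b → c a ≠ c b)
    {w a b : V} (hab : a ≠ b) (ha : H.Adj w a) (hb : H.Adj w b) (hdeg : H.degree w ≤ 2)
    (hw : orientedBoundary k c H w = 0) : c a < c w ↔ c w < c b := by
  have hN : {a, b} = H.neighborFinset w := by
    refine Finset.eq_of_subset_of_card_le ?_ ?_
    · intro x hx
      rcases Finset.mem_insert.1 hx with rfl | hx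
      · simpa using ha
      · rw [Finset.mem_singleton.1 hx]; simpa using hb
    · rw [Finset.card_pair hab]; exact hdeg
  rw [orientedBoundary_eq_sum_neighborFinset, ← hN, Finset.sum_pair hab] at hw
  have h2 : (2 : ZMod k) ≠ 0 := by
    exact_mod_cast ZMod.natCast_ne_zero_of_lt (k := k) two_pos (by lia)
  have := hc _ _ hb
  split_ifs at hw with h h' h'
  · exact absurd (by linear_combination hw) h2
  · exact ⟨fun _ => by lia, fun _ => h⟩
  · exact ⟨fun h'' => absurd h'' h, fun _ => by lia⟩
  · exact absurd (by linear_combination -hw) h2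

theorem orientedBoundary_bot : orientedBoundary k c (⊥ : SimpleGraph V) = 0 := by
  funext w
  simp [orientedBoundary]

theorem eq_bot_of_orientedBoundary_eq_zero (hk : 3 ≤ k) (hH : H.IsAcyclic)
    (h : orientedBoundary k c H = 0) : H = ⊥ := by
  classical
  by_contra hne
  obtain ⟨w, hw⟩ := hH.exists_degree_eq_one hne
  exact orientedBoundary_ne_zero_of_degree_eq_one (c := c) hk hw (congrFun h w)

theorem orientedBoundary_sup_edge [DecidableEq V] {u v : V} (huv : c u ≠ c v)
    (hadj : ¬ H.Adj u v) :
    orientedBoundary k c (H ⊔ SimpleGraph.edge u v) = orientedBoundary k c H +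
      (if c v < c u then 1 else -1 : ZMod k) • (Pi.single u 1 - Pi.single v 1) := by
  classical
  have hne : u ≠ v := fun h => huv (h ▸ rfl)
  funext w
  have hadj' : ¬ H.Adj v u := fun h => hadj h.symm
  trans ∑ x, ((if H.Adj w x then (if c x < c w then 1 else -1) else 0 : ZMod k) +
      (if x = v then (if w = u then (if c v < c u then 1 else -1) else 0) else 0) +
      (if x = u then (if w = v then (if c u < c v then 1 else -1) else 0) else 0))
  · refine Finset.sum_congr rfl fun x _ => ?_
    simp only [SimpleGraph.sup_adj, SimpleGraph.edge_adj]
    by_cases h1 : w = u <;> by_cases h2 : w = v <;> by_cases h3 : x = u <;> by_cases h4 : x = v <;>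
      simp_all
  · simp only [orientedBoundary, Finset.sum_add_distrib, Finset.sum_ite_eq', Finset.mem_univ,
      if_true, Pi.add_apply, Pi.smul_apply, Pi.sub_apply, Pi.single_apply, smul_eq_mul, add_assoc]
    congr 1
    have h : c u < c v ↔ ¬ c v < c u := by lia
    simp only [h, ite_not]
    split_ifs <;> simp_all

end Boundary

section Length

/-- A sequence of naturals in `[0, k]` without constant steps has a turning point in each
window of `k` consecutive interior positions. -/
theorem exists_turning_point {k : ℕ} {f : ℕ → ℕ} (hf : ∀ i ≤ k, f i ≠ f (i + 1))
    (hle : ∀ i ≤ k + 1, f i ≤ k) : ∃ i < k, ¬ (f i < f (i + 1) ↔ f (i + 1) < f (i + 2)) := by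
  by_contra! h
  rcases lt_or_gt_of_ne (hf 0 (Nat.zero_le _)) with h0 | h0
  · have key (i : ℕ) : i ≤ k → f i < f (i + 1) ∧ i + 1 ≤ f (i + 1) := by
      induction i with
      | zero => exact fun _ => ⟨h0, by lia⟩
      | succ i ih =>
        intro hi
        have := ih (by lia)
        have h2 := (h i (by lia)).1 this.1
        exact ⟨h2, by lia⟩
    have := key k le_rfl
    have := hle (k + 1) le_rfl
    lia
  · have key (i : ℕ) : i ≤ k → f (i + 1) < f i ∧ f (i + 1) + i + 1 ≤ f 0 := by
      induction i with
      | zero => exact fun _ => ⟨h0, by simpa using h0⟩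
      | succ i ih =>
        intro hi
        have h1 := ih (by lia)
        have h2 := h i (by lia)
        have h3 := hf (i + 1) hi
        have h4 : f (i + 2) < f (i + 1) := by
          have : ¬ f (i + 1) < f (i + 2) := fun h' => by have := h2.2 h'; lia
          have h5 : f (i + 1) ≠ f (i + 2) := h3
          lia
        exact ⟨h4, by show f (i + 2) + (i + 1) + 1 ≤ f 0; lia⟩
    have := key k le_rfl
    have := hle 0 (by lia)
    lia

variable {V : Type*} [Fintype V] {H : SimpleGraph V} {c : V → ℕ} {k : ℕ}

open scoped Classical in
/-- Paths in a forest are short when the boundary of the forest has small support. -/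
theorem SimpleGraph.Walk.IsPath.length_le_of_orientedBoundary (hk : 3 ≤ k) (hck : ∀ v, c v ≤ k)
    (hc : ∀ a b, H.Adj a b → c a ≠ c b) (hH : H.IsAcyclic) {u v : V} {p : H.Walk u v}
    (hp : p.IsPath) :
    p.length ≤ k * (2 * (Finset.univ.filter fun w => orientedBoundary k c H w ≠ 0).card + 1) := by
  set B := Finset.univ.filter fun w => orientedBoundary k c H w ≠ 0 with hB
  let T := Finset.univ.filter fun w => 3 ≤ H.degree w
  have hT : T.card ≤ B.card := hH.card_three_le_degree_le.trans <| Finset.card_le_card fun w hw => by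
    simp only [Finset.mem_filter, Finset.mem_univ, true_and, hB] at hw ⊢
    exact orientedBoundary_ne_zero_of_degree_eq_one hk hw
  by_contra! hlen
  have hex (i : ℕ) (hi : i < 2 * B.card + 1) :
      ∃ j < k, p.getVert (i * k + j + 1) ∈ T ∪ B := by
    have hik : (i + 1) * k + 1 ≤ p.length := by
      have : (i + 1) * k ≤ (2 * B.card + 1) * k := Nat.mul_le_mul_right _ hi
      rw [mul_comm (2 * B.card + 1)] at this
      lia
    rw [add_mul, one_mul] at hik
    obtain ⟨j, hj, hturn⟩ := exists_turning_point (k := k) (f := fun j => c (p.getVert (i * k + j)))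
      (fun j hj => hc _ _ (p.adj_getVert_succ (by lia))) (fun j _ => hck _)
    refine ⟨j, hj, ?_⟩
    by_contra hmem
    simp only [T, hB, Finset.mem_union, Finset.mem_filter, Finset.mem_univ, true_and, not_or,
      not_le, not_not] at hmem
    refine hturn (lt_iff_lt_of_orientedBoundary_eq_zero hk hc ?_
      (p.adj_getVert_succ (by lia)).symm (p.adj_getVert_succ (i := i * k + j + 1) (by lia))
      (Nat.le_of_lt_succ hmem.1) hmem.2)
    intro h
    have := hp.getVert_injOn (by simp; lia) (by simp; lia) h
    lia
  choose! g hgk hg using hex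
  have hcard : (Finset.range (2 * B.card + 1)).card ≤ (T ∪ B).card := by
    refine Finset.card_le_card_of_injOn (fun i => p.getVert (i * k + g i + 1))
      (fun i hi => hg i (by simpa using hi)) fun a ha b hb hab => ?_
    simp only [Finset.coe_range, Set.mem_Iio] at ha hb
    have hlt (i : ℕ) (hi : i < 2 * B.card + 1) : i * k + g i + 1 ≤ p.length := by
      have : (i + 1) * k ≤ (2 * B.card + 1) * k := Nat.mul_le_mul_right _ hi
      rw [mul_comm (2 * B.card + 1), add_mul] at this
      have := hgk i hi
      lia
    have h := hp.getVert_injOn (by simpa using hlt a ha) (by simpa using hlt b hb) hab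
    have hdiv (i : ℕ) (hi : i < 2 * B.card + 1) : (i * k + g i) / k = i := by
      rw [add_comm, Nat.add_mul_div_right _ _ (by lia), Nat.div_eq_of_lt (hgk i hi), zero_add]
    rw [← hdiv a ha, ← hdiv b hb, Nat.add_right_cancel h]
  have := Finset.card_union_le T B
  rw [Finset.card_range] at hcard
  lia

end Length

section Certificate

variable {V : Type*} [Fintype V] {c : V → ℕ} {k : ℕ}

/-- In a graph of large girth, an edge can be added to a forest whose boundary has small
support without creating a cycle. -/
theorem SimpleGraph.IsAcyclic.sup_edge_of_lt_egirth {G H : SimpleGraph V} [DecidableEq V]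
    (hk : 3 ≤ k) (hck : ∀ v, c v ≤ k) (hc : ∀ a b, G.Adj a b → c a ≠ c b) (hHG : H ≤ G)
    (hH : H.IsAcyclic) {u v : V} (huv : G.Adj u v) (hadj : ¬ H.Adj u v) {B : Finset V}
    (hB : ∀ w, orientedBoundary k c H w ≠ 0 → w ∈ B)
    (hg : ((k * (2 * B.card + 1) + 1 : ℕ) : ℕ∞) < G.egirth) :
    (H ⊔ SimpleGraph.edge u v).IsAcyclic := by
  classical
  refine hH.sup_edge_of_not_reachable fun hr => ?_
  obtain ⟨p, hp⟩ := hr.symm.exists_isPath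
  have hlen := hp.length_le_of_orientedBoundary hk hck (fun a b h => hc a b (hHG h)) hH
  have hcyc : (SimpleGraph.Walk.cons huv (p.mapLe hHG)).IsCycle := by
    rw [SimpleGraph.Walk.cons_isCycle_iff]
    refine ⟨hp.mapLe hHG, fun he => hadj ?_⟩
    rw [SimpleGraph.Walk.edges_mapLe_eq_edges] at he
    exact p.adj_of_mem_edges he
  refine hg.not_ge ((SimpleGraph.egirth_le_length hcyc).trans ?_)
  have hcard : (Finset.univ.filter fun w => orientedBoundary k c H w ≠ 0).card ≤ B.card :=
    Finset.card_le_card fun w hw => hB w (Finset.mem_filter.1 hw).2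
  have : p.length ≤ k * (2 * B.card + 1) := hlen.trans (Nat.mul_le_mul_left k (by lia))
  simp only [SimpleGraph.Walk.length_cons, SimpleGraph.Walk.length_map]
  exact_mod_cast Nat.add_le_add_right this 1

open scoped Classical in
/-- The signed count of the forests in `G` with a prescribed boundary. -/
noncomputable def signedForestCount (K : Type*) [CommRing K] (G : SimpleGraph V) (k : ℕ)
    (c : V → ℕ) (β : V → ZMod k) : K :=
  ∑ H : SimpleGraph V with (H ≤ G ∧ H.IsAcyclic) ∧ orientedBoundary k c H = β,
    (-1) ^ H.edgeSet.ncard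

variable (K : Type*) [CommRing K] {G : SimpleGraph V}

theorem signedForestCount_zero (hk : 3 ≤ k) : signedForestCount K G k c 0 = 1 := by
  classical
  rw [signedForestCount, Finset.sum_eq_single ⊥]
  · simp
  · intro H hH hne
    have hH := (Finset.mem_filter.1 hH).2
    exact absurd (eq_bot_of_orientedBoundary_eq_zero hk hH.1.2 hH.2) hne
  · intro h
    exact absurd (Finset.mem_filter.2 ⟨Finset.mem_univ _, ⟨bot_le, SimpleGraph.isAcyclic_bot⟩,
      orientedBoundary_bot⟩) h

theorem SimpleGraph.ncard_edgeSet_sup_edge {H : SimpleGraph V} {u v : V} (hne : u ≠ v)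
    (hadj : ¬ H.Adj u v) :
    (H ⊔ SimpleGraph.edge u v).edgeSet.ncard = H.edgeSet.ncard + 1 := by
  rw [SimpleGraph.edgeSet_sup, SimpleGraph.edgeSet_edge_of_ne hne, Set.union_singleton,
    Set.ncard_insert_of_notMem (by simpa using hadj)]

open scoped symmDiff in
/-- Toggling the edge `uv` in forests cancels the contributions to the sum over a line of
boundaries in direction `e_u - e_v`. -/
theorem sum_signedForestCount_eq_zero [DecidableEq V] [NeZero k] {u v : V} (huv : G.Adj u v)
    (hc : c u ≠ c v) (β : V → ZMod k)
    (hcyc : ∀ (H : SimpleGraph V) (r : ZMod k), H ≤ G → H.IsAcyclic →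
      orientedBoundary k c H = β + r • (Pi.single u 1 - Pi.single v 1) → ¬ H.Adj u v →
      (H ⊔ SimpleGraph.edge u v).IsAcyclic) :
    ∑ r ∈ Finset.range k,
      signedForestCount K G k c (β + (r : ZMod k) • (Pi.single u 1 - Pi.single v 1)) = 0 := by
  classical
  have hne : u ≠ v := huv.ne
  set D : V → ZMod k := Pi.single u 1 - Pi.single v 1 with hD
  have hDu : D u = 1 := by simp [hD, hne]
  simp only [signedForestCount]
  rw [← Finset.sum_biUnion]
  swap
  · intro r hr s hs hrs
    simp only [Finset.coe_range, Set.mem_Iio] at hr hs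
    refine Finset.disjoint_left.2 fun H hH hH' => hrs ?_
    have h := congrFun ((Finset.mem_filter.1 hH).2.2.symm.trans (Finset.mem_filter.1 hH').2.2) u
    simp only [Pi.add_apply, Pi.smul_apply, hDu, smul_eq_mul, mul_one, add_right_inj] at h
    rw [ZMod.natCast_eq_natCast_iff] at h
    exact h.eq_of_lt_of_lt hr hs
  rw [Finset.sum_congr (s₂ := Finset.univ.filter fun H : SimpleGraph V => (H ≤ G ∧ H.IsAcyclic) ∧
    ∃ r : ZMod k, orientedBoundary k c H = β + r • D) (g := fun H => (-1) ^ H.edgeSet.ncard) ?_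
    fun _ _ => rfl]
  swap
  · ext H
    simp only [Finset.mem_biUnion, Finset.mem_range, Finset.mem_filter, Finset.mem_univ, true_and]
    constructor
    · rintro ⟨r, -, h, h'⟩
      exact ⟨h, r, h'⟩
    · rintro ⟨h, r, h'⟩
      exact ⟨r.val, r.val_lt, h, by rwa [ZMod.natCast_zmod_val]⟩
  have hedge (H : SimpleGraph V) : SimpleGraph.edge u v ≤ H ↔ H.Adj u v := by
    simp [hne]
  have hsup {H : SimpleGraph V} (h : ¬ H.Adj u v) :
      H ∆ SimpleGraph.edge u v = H ⊔ SimpleGraph.edge u v :=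
    Disjoint.symmDiff_eq_sup ((SimpleGraph.disjoint_edge H).2 h)
  have hsign {H : SimpleGraph V} (h : ¬ H.Adj u v) :
      (-1 : K) ^ H.edgeSet.ncard + (-1) ^ (H ∆ SimpleGraph.edge u v).edgeSet.ncard = 0 := by
    rw [hsup h, SimpleGraph.ncard_edgeSet_sup_edge hne h, pow_succ]
    ring
  have hnot {H : SimpleGraph V} (h : H.Adj u v) : ¬ (H ∆ SimpleGraph.edge u v).Adj u v := by
    rw [symmDiff_of_ge ((hedge H).2 h)]
    simp [SimpleGraph.edge_adj, hne]
  refine Finset.sum_involution (fun H _ => H ∆ SimpleGraph.edge u v) ?_ ?_ ?_ ?_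
  · intro H _
    by_cases h : H.Adj u v
    · have := hsign (hnot h)
      rwa [symmDiff_symmDiff_cancel_right, add_comm] at this
    · exact hsign h
  · intro H _ _ h
    exact (hedge ⊥).1 (symmDiff_eq_left.1 h).le
  · intro H hH
    simp only [Finset.mem_filter, Finset.mem_univ, true_and] at hH ⊢
    obtain ⟨⟨hle, hac⟩, r, hr⟩ := hH
    by_cases h : H.Adj u v
    · have hle' : H ∆ SimpleGraph.edge u v ≤ H := by
        rw [symmDiff_of_ge ((hedge H).2 h)]
        exact sdiff_le
      refine ⟨⟨hle'.trans hle, hac.anti hle'⟩, ?_⟩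
      have hb := orientedBoundary_sup_edge (k := k) hc (hnot h)
      rw [← hsup (hnot h), symmDiff_symmDiff_cancel_right, hr, ← hD] at hb
      exact ⟨r - (if c v < c u then 1 else -1), by rw [sub_smul, ← add_sub_assoc, hb]; abel⟩
    · rw [hsup h]
      refine ⟨⟨sup_le hle ((SimpleGraph.edge_le_iff G).2 (Or.inr huv)), hcyc H r hle hac hr h⟩,
        r + (if c v < c u then 1 else -1), ?_⟩
      rw [orientedBoundary_sup_edge hc h, hr, add_smul, add_assoc]
  · intro H _
    exact symmDiff_symmDiff_cancel_right _ _

end Certificate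

theorem ZMod.card_filter_ne_zero_le_sum_val {V : Type*} [Fintype V] {k : ℕ} [NeZero k]
    (α : V → ZMod k) : (Finset.univ.filter fun v => α v ≠ 0).card ≤ ∑ v, (α v).val := by
  rw [Finset.card_filter]
  refine Finset.sum_le_sum fun v _ => ?_
  split_ifs with h
  · exact Nat.pos_of_ne_zero fun h' => h ((ZMod.val_eq_zero _).1 h')
  · exact Nat.zero_le _

/-- If `G` has chromatic number `k+1` (with `k ≥ 3`) and girth `g > 4k`, and `K` is an
algebraically closed field whose characteristic does not divide `k`, then for every
`d` with `4k(d + k - 1) < g` there is a dual Nullstellensatz certificate of degree `d`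
for `G` over `K`. -/
theorem exists_dual_certificate_of_large_girth
    {V : Type*} [Fintype V] [DecidableEq V]
    (K : Type*) [Field K] [IsAlgClosed K]
    (k : ℕ) (hk : 3 ≤ k) (hchar : ¬ (ringChar K ∣ k))
    (G : SimpleGraph V)
    (hchrom : G.chromaticNumber = ((k + 1 : ℕ) : ℕ∞))
    (hgirth : ((4 * k : ℕ) : ℕ∞) < G.egirth)
    (d : ℕ) (hd : ((4 * k * (d + k - 1) : ℕ) : ℕ∞) < G.egirth) :
    ∃ lam : (V → ZMod k) → K, IsDualCert K G k d lam := by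
  have : NeZero k := ⟨by lia⟩
  obtain ⟨C⟩ := SimpleGraph.chromaticNumber_le_iff_colorable.1 hchrom.le
  refine ⟨signedForestCount K G k fun w => (C w : ℕ), signedForestCount_zero K hk,
    fun α hα u v huv => ?_⟩
  have hC (a b : V) (h : G.Adj a b) : (C a : ℕ) ≠ C b := fun h' => C.valid h (Fin.ext h')
  simp only [add_sub_right_comm]
  refine sum_signedForestCount_eq_zero K huv (hC u v huv) _ fun H r hle hH hr hadj => ?_
  refine hH.sup_edge_of_lt_egirth (B := insert u (insert v (Finset.univ.filter (α · ≠ 0)))) hk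
    (fun w => Nat.le_of_lt_succ (C w).2) hC hle huv hadj (fun w hw => ?_) (lt_of_le_of_lt ?_ hd)
  · contrapose! hw
    simp only [Finset.mem_insert, Finset.mem_filter, Finset.mem_univ, true_and, not_or,
      not_not] at hw
    simp [hr, hw]
  · have h1 := Finset.card_insert_le u (insert v (Finset.univ.filter (α · ≠ 0)))
    have h2 := Finset.card_insert_le v (Finset.univ.filter (α · ≠ 0))
    have h3 := ZMod.card_filter_ne_zero_le_sum_val α
    norm_cast
    calc k * (2 * (insert u (insert v (Finset.univ.filter (α · ≠ 0)))).card + 1) + 1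
        ≤ k * (2 * (d + 2) + 1) + k * 1 :=
          Nat.add_le_add (Nat.mul_le_mul_left k (by lia)) (by lia)
      _ = k * (2 * d + 6) := by ring
      _ ≤ k * (4 * (d + k - 1)) := Nat.mul_le_mul_left k (by lia)
      _ = 4 * k * (d + k - 1) := by ring
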